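/- Let u_a, u_b, u_c : [0,T] → ℝ be bounded measurable functions and let S be the unique noncommutative power series with zero constant term satisfying S = b − a·exp⧢(2S)·c. Then there exists T′ ∈ (0,T] such that for every t ∈ [0,T′] the series Ξ_a(t) := Σ_{w∈A*} ⟨a·exp⧢(2S), w⟩·Υ^t(w) converges absolutely, and the function Ξ_a is absolutely continuous on [0,T′] with Ξ_a(0) = 0 and Ξ_a′(t) = u_a(t) + 2u_b(t)·Ξ_a(t) − u_c(t)·Ξ_a(t)² for almost every t ∈ [0,T′]; that is, Ξ_a is locally the solution of the Riccati equation with zero initial condition. -/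

import Mathlib

/-! STATEMENT 4: `Ξ_a(t) = Σ_w ⟨a·exp⧢(2S), w⟩·Υ^t(w)` is locally the solution
of the Riccati equation `Ξ_a′ = u_a + 2u_b·Ξ_a − u_c·Ξ_a²`, `Ξ_a(0) = 0`. -/

/-! STATEMENT 0: Existence and uniqueness of the noncommutative power series
`S = b − a·exp⧢(2S)·c` with zero constant term. -/

/-- The three-letter alphabet `A = {a, b, c}`. -/
inductive Letter : Type
  | a | b | c
deriving DecidableEq

/-- Words on the alphabet. -/
abbrev Word := List Letter

/-- Noncommutative power series over `ℝ` on the alphabet: a real coefficient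
for every word. -/
abbrev Series := Word → ℝ

/-- The series associated to a single word (coefficient `1` on that word, `0` elsewhere). -/
def ofWord (v : Word) : Series := fun w => if w = v then 1 else 0

/-- Concatenation product of series: `⟨PQ, w⟩ = Σ_{uv = w} ⟨P,u⟩⟨Q,v⟩`. -/
noncomputable def cmul (P Q : Series) : Series :=
  fun w => ∑ i ∈ Finset.range (w.length + 1), P (w.take i) * Q (w.drop i)

/-- The subword of `w` selected by a boolean mask. -/
def select (w : Word) (m : List Bool) : Word :=
  ((w.zip m).filter (fun p => p.2)).map Prod.fst

/-- The (bilinear) shuffle product of two series: the coefficient on `w` is the sum,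
over all splittings of the positions of `w` into two complementary subsets, of the
product of the coefficients of the two selected subwords.  This is the bilinear
product determined on words by `ε⧢w = w⧢ε = w` and
`(w₁a₁)⧢(w₂a₂) = (w₁⧢(w₂a₂))a₁ + ((w₁a₁)⧢w₂)a₂`. -/
noncomputable def shuffle (P Q : Series) : Series := fun w =>
  ∑ m : Fin w.length → Bool,
    P (select w (List.ofFn m)) * Q (select w (List.ofFn (fun i => ! m i)))

/-- Shuffle powers `P^{⧢k}`. -/
noncomputable def shufPow (P : Series) : ℕ → Series
  | 0 => ofWord []
  | k + 1 => shuffle (shufPow P k) P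

/-- The shuffle exponential `exp⧢(P) = ε + Σ_{k≥1} P^{⧢k}/k!` (for `P` with zero
constant term only finitely many terms contribute to each coefficient). -/
noncomputable def shufExp (P : Series) : Series :=
  fun w => ∑' k : ℕ, ((k.factorial : ℝ))⁻¹ * shufPow P k w

/-- Iterated integral on the reversed word:
`UpsRev u (aₙ…a₁) t = ∫₀^t u_{aₙ}(s)·UpsRev u (a_{n−1}…a₁) s ds`. -/
noncomputable def UpsRev (u : Letter → ℝ → ℝ) : Word → ℝ → ℝ
  | [], _ => 1
  | d :: w, t => ∫ s in (0 : ℝ)..t, u d s * UpsRev u w s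

/-- The iterated integral
`Υ^t(a₁⋯aₙ) = ∫₀^t u_{aₙ}(tₙ) ∫₀^{tₙ} ⋯ ∫₀^{t₂} u_{a₁}(t₁) dt₁ ⋯ dtₙ`, with `Υ^t(ε) = 1`. -/
noncomputable def Ups (u : Letter → ℝ → ℝ) (w : Word) (t : ℝ) : ℝ := UpsRev u w.reverse t

open MeasureTheory

/-- Left derivation of a series: removal of the first letter. -/
def leftDer (d : Letter) (P : Series) : Series := fun w => P (d :: w)

/-- Right derivation of a series: removal of the last letter. -/
def rightDer (d : Letter) (P : Series) : Series := fun w => P (w ++ [d])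

@[simp] theorem leftDer_apply (d : Letter) (P : Series) (w : Word) :
    leftDer d P w = P (d :: w) := rfl

@[simp] theorem rightDer_apply (d : Letter) (P : Series) (w : Word) :
    rightDer d P w = P (w ++ [d]) := rfl

@[simp] theorem shuffle_nil (P Q : Series) : shuffle P Q [] = P [] * Q [] := by
  simp [shuffle, select]

theorem shuffle_cons (P Q : Series) (d : Letter) (w : Word) :
    shuffle P Q (d :: w) = shuffle (leftDer d P) Q w + shuffle P (leftDer d Q) w := by
  have h := (Fin.consEquiv (fun _ : Fin (w.length + 1) => Bool)).sum_comp
    (fun m => P (select (d :: w) (List.ofFn m)) * Q (select (d :: w) (List.ofFn (fun i => ! m i))))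
  rw [Fintype.sum_prod_type, Fintype.sum_bool] at h
  refine h.symm.trans ?_
  simp [shuffle, Fin.consEquiv, List.ofFn_succ, select]

theorem shuffle_add_left (P Q R : Series) : shuffle (P + Q) R = shuffle P R + shuffle Q R := by
  funext w; simp [shuffle, add_mul, Finset.sum_add_distrib]

theorem shuffle_add_right (P Q R : Series) : shuffle P (Q + R) = shuffle P Q + shuffle P R := by
  funext w; simp [shuffle, mul_add, Finset.sum_add_distrib]

theorem shuffle_smul_left (r : ℝ) (P Q : Series) : shuffle (r • P) Q = r • shuffle P Q := by
  funext w; simp [shuffle, mul_assoc, Finset.mul_sum]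

theorem shuffle_smul_right (r : ℝ) (P Q : Series) : shuffle P (r • Q) = r • shuffle P Q := by
  funext w; simp [shuffle, mul_left_comm, Finset.mul_sum]

theorem leftDer_shuffle (d : Letter) (P Q : Series) :
    leftDer d (shuffle P Q) = shuffle (leftDer d P) Q + shuffle P (leftDer d Q) :=
  funext fun w => shuffle_cons P Q d w

theorem shuffle_comm (P Q : Series) : shuffle P Q = shuffle Q P := by
  funext w
  induction w generalizing P Q with
  | nil => simp [mul_comm]
  | cons d w ih => rw [shuffle_cons, shuffle_cons, ih, ih P, add_comm]

theorem shuffle_assoc (P Q R : Series) :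
    shuffle (shuffle P Q) R = shuffle P (shuffle Q R) := by
  funext w
  induction w generalizing P Q R with
  | nil => simp [mul_assoc]
  | cons d w ih =>
    simp only [shuffle_cons, leftDer_shuffle, shuffle_add_left, shuffle_add_right, Pi.add_apply, ih]
    ring

theorem shuffle_right_comm (P Q R : Series) :
    shuffle (shuffle P Q) R = shuffle (shuffle P R) Q := by
  rw [shuffle_assoc, shuffle_comm Q, shuffle_assoc]

theorem rightDer_shuffle (d : Letter) (P Q : Series) :
    rightDer d (shuffle P Q) = shuffle (rightDer d P) Q + shuffle P (rightDer d Q) := by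
  funext w
  induction w generalizing P Q with
  | nil => simp [shuffle_cons]
  | cons e w ih =>
    simp only [rightDer_apply, Pi.add_apply] at ih
    simp only [rightDer_apply, List.cons_append, Pi.add_apply, shuffle_cons, ih]
    have h : ∀ P, leftDer e (rightDer d P) = rightDer d (leftDer e P) := fun P => rfl
    rw [h, h]
    ring

theorem shuffle_reverse (P Q : Series) (w : Word) :
    shuffle P Q w.reverse =
      shuffle (fun v => P v.reverse) (fun v => Q v.reverse) w := by
  induction w generalizing P Q with
  | nil => simp
  | cons d w ih =>
    have h := congrFun (rightDer_shuffle d P Q) w.reverse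
    simp only [rightDer_apply, Pi.add_apply] at h
    have e : ∀ P : Series, leftDer d (fun v => P v.reverse) =
        fun v => rightDer d P v.reverse := fun P => by funext v; simp
    rw [List.reverse_cons, h, ih, ih, shuffle_cons, e, e]

@[simp] theorem one_shuffle (P : Series) : shuffle (ofWord []) P = P := by
  funext w
  induction w generalizing P with
  | nil => simp [ofWord]
  | cons d w ih =>
    have h : leftDer d (ofWord []) = (0 : ℝ) • ofWord [] := by funext w; simp [ofWord]
    rw [shuffle_cons, ih, h, shuffle_smul_left]
    simp

theorem rightDer_shufPow (d : Letter) (P : Series) (k : ℕ) :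
    rightDer d (shufPow P (k + 1)) = ((k : ℝ) + 1) • shuffle (shufPow P k) (rightDer d P) := by
  induction k with
  | zero => simp [shufPow]
  | succ k ih =>
    rw [shufPow, rightDer_shuffle, ih, shuffle_smul_left, shuffle_right_comm, ← shufPow]
    push_cast
    module

theorem rightDer_shufPow_zero (d : Letter) (P : Series) : rightDer d (shufPow P 0) = 0 := by
  funext w; simp [shufPow, ofWord]

theorem shufPow_eq_zero (P : Series) (hP : P [] = 0) (k : ℕ) (w : Word) (h : w.length < k) :
    shufPow P k w = 0 := by
  have key : ∀ (n : ℕ) (Q R : Series), (∀ v : Word, v.length < n → Q v = 0) →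
      ∀ v : Word, v.length < n → shuffle Q R v = 0 := by
    intro n
    induction n with
    | zero => simp
    | succ n ih =>
      intro Q R hQ v hv
      induction v generalizing R with
      | nil => simp [hQ]
      | cons d v ihv =>
        rw [shuffle_cons, ihv _ (by grind), ih, add_zero]
        · intro w hw
          exact hQ _ (by simpa using hw)
        · simpa using hv
  have key' : ∀ (v : Word) (n : ℕ) (Q R : Series), (∀ v : Word, v.length < n → Q v = 0) →
      R [] = 0 → v.length < n + 1 → shuffle Q R v = 0 := by
    intro v
    induction v with
    | nil => simp +contextual
    | cons d v ih =>
      intro n Q R hQ hR hv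
      have hv' : v.length < n := by simpa using hv
      obtain ⟨m, rfl⟩ : ∃ m, n = m + 1 := ⟨n - 1, by omega⟩
      rw [shuffle_cons, key _ Q _ hQ v hv', add_zero]
      exact ih m _ _ (fun w hw => hQ _ (by simpa using hw)) hR hv'
  induction k generalizing w with
  | zero => simp at h
  | succ k ih => exact key' w k _ _ ih hP h

theorem hasSum_shufExp (P : Series) (hP : P [] = 0) (w : Word) :
    HasSum (fun k : ℕ => ((k.factorial : ℝ))⁻¹ * shufPow P k w) (shufExp P w) := by
  refine (summable_of_ne_finset_zero (s := Finset.range (w.length + 1)) fun k hk => ?_).hasSum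
  rw [shufPow_eq_zero P hP k w (by simpa using hk), mul_zero]

@[simp] theorem shufExp_nil (P : Series) (hP : P [] = 0) : shufExp P [] = 1 := by
  refine (hasSum_shufExp P hP []).unique ?_
  convert! hasSum_single 0 fun k hk => ?_
  · simp [shufPow, ofWord]
  · rw [shufPow_eq_zero P hP k [] (by simpa using Nat.pos_of_ne_zero hk), mul_zero]

theorem hasSum_shuffle_shufExp (P Q : Series) (hP : P [] = 0) (w : Word) :
    HasSum (fun k : ℕ => ((k.factorial : ℝ))⁻¹ * shuffle (shufPow P k) Q w)
      (shuffle (shufExp P) Q w) := by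
  simp only [shuffle, Finset.mul_sum, ← mul_assoc]
  exact hasSum_sum fun m _ => (hasSum_shufExp P hP _).mul_right _

theorem rightDer_shufExp (d : Letter) (P : Series) (hP : P [] = 0) :
    rightDer d (shufExp P) = shuffle (shufExp P) (rightDer d P) := by
  funext w
  refine (hasSum_shufExp P hP _).unique ?_
  rw [← hasSum_nat_add_iff' 1]
  convert! hasSum_shuffle_shufExp P (rightDer d P) hP w using 1
  · funext k
    have h := congrFun (rightDer_shufPow d P k) w
    rw [rightDer_apply] at h
    have : (k : ℝ) + 1 ≠ 0 := by positivity
    rw [h, Nat.factorial_succ]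
    simp only [Pi.smul_apply, smul_eq_mul]
    push_cast
    field_simp
  · have h := congrFun (rightDer_shufPow_zero d P) w
    rw [rightDer_apply] at h
    simp [h]

@[simp] theorem cmul_letter_nil (d : Letter) (Q : Series) : cmul (ofWord [d]) Q [] = 0 := by
  simp [cmul, ofWord]

theorem cmul_letter_cons (d e : Letter) (Q : Series) (w : Word) :
    cmul (ofWord [d]) Q (e :: w) = if e = d then Q w else 0 := by
  rw [cmul, Finset.sum_eq_single 1]
  · simp [ofWord]
  · intro i hi h1
    have : (e :: w).take i ≠ [d] := fun h => by
      have := congrArg List.length h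
      simp at this hi
      omega
    simp [ofWord, this]
  · simp

@[simp] theorem cmul_nil_letter (d : Letter) (Q : Series) : cmul Q (ofWord [d]) [] = 0 := by
  simp [cmul, ofWord]

theorem cmul_concat_letter (d e : Letter) (Q : Series) (w : Word) :
    cmul Q (ofWord [d]) (w ++ [e]) = if e = d then Q w else 0 := by
  rw [cmul, Finset.sum_eq_single w.length]
  · simp [ofWord]
  · intro i hi h1
    have : (w ++ [e]).drop i ≠ [d] := fun h => by
      have := congrArg List.length h
      simp at this hi
      omega
    simp [ofWord, this]
  · simp

/-- The series `X = a·exp⧢(2S)` satisfies `X = a + 2Xb - (X⧢X)c`. -/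
theorem cmul_shufExp_concat (S : Series) (h0 : S [] = 0)
    (hS : S = ofWord [Letter.b] -
        cmul (ofWord [Letter.a]) (cmul (shufExp ((2 : ℝ) • S)) (ofWord [Letter.c])))
    (X : Series) (hX : X = cmul (ofWord [Letter.a]) (shufExp ((2 : ℝ) • S)))
    (d : Letter) (w : Word) :
    X (w ++ [d]) = (if d = Letter.a ∧ w = [] then 1 else 0) +
      (if d = Letter.b then 2 * X w else 0) - (if d = Letter.c then shuffle X X w else 0) := by
  have hP : ((2 : ℝ) • S) [] = 0 := by simp [h0]
  have hX0 : X [] = 0 := by simp [hX]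
  have hXc : ∀ e v, X (e :: v) = if e = Letter.a then shufExp ((2 : ℝ) • S) v else 0 :=
    fun e v => by rw [hX, cmul_letter_cons]
  have hSd : rightDer d ((2 : ℝ) • S) =
      (if d = Letter.b then (2 : ℝ) else 0) • ofWord [] -
        (if d = Letter.c then (2 : ℝ) else 0) • X := by
    funext v
    simp only [rightDer_apply, Pi.smul_apply, Pi.sub_apply, smul_eq_mul]
    rw [hS]
    cases v with
    | nil =>
      rw [Pi.sub_apply, List.nil_append, cmul_letter_cons, cmul_nil_letter, hX0]
      simp [ofWord]
    | cons e v =>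
      rw [Pi.sub_apply, List.cons_append, cmul_letter_cons, cmul_concat_letter, hXc]
      by_cases h1 : e = Letter.a <;> by_cases h2 : d = Letter.c <;> simp [ofWord, h1, h2]
  cases w with
  | nil =>
    rw [List.nil_append, hXc, shufExp_nil _ hP]
    simp [hX0]
  | cons e v =>
    have h := congrFun (rightDer_shufExp d _ hP) v
    rw [rightDer_apply, hSd, sub_eq_add_neg, ← neg_smul, shuffle_add_right, shuffle_smul_right,
      shuffle_smul_right, shuffle_comm _ (ofWord []), one_shuffle] at h
    simp only [Pi.add_apply, Pi.smul_apply, smul_eq_mul] at h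
    rw [List.cons_append, hXc, h, hXc, shuffle_cons, shuffle_comm X]
    by_cases h1 : e = Letter.a
    · have : leftDer e X = shufExp ((2 : ℝ) • S) := by funext v; simp [hXc, h1]
      rw [this]
      by_cases h2 : d = Letter.c <;> by_cases h3 : d = Letter.b <;> simp [h1, h2, h3] <;> ring
    · have : leftDer e X = (0 : ℝ) • X := by funext v; simp [hXc, h1]
      rw [this, shuffle_smul_left]
      simp [h1]

instance : Fintype Letter := ⟨{Letter.a, Letter.b, Letter.c}, by rintro (_ | _ | _) <;> simp⟩

theorem sum_letter (f : Letter → ℝ) : ∑ d, f d = f Letter.a + f Letter.b + f Letter.c := by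
  simp [Finset.univ, Fintype.elems, add_assoc]

/-- The sum of the coefficients of a series over all words of length `n`. -/
def levelSum (n : ℕ) (f : Series) : ℝ := ∑ x : Fin n → Letter, f (List.ofFn x)

@[simp] theorem levelSum_zero (f : Series) : levelSum 0 f = f [] := by
  simp [levelSum]

theorem levelSum_succ (n : ℕ) (f : Series) :
    levelSum (n + 1) f = ∑ d, levelSum n (leftDer d f) := by
  have h := (Fin.consEquiv (fun _ : Fin (n + 1) => Letter)).sum_comp (fun x => f (List.ofFn x))
  rw [Fintype.sum_prod_type] at h
  refine h.symm.trans ?_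
  simp [levelSum, Fin.consEquiv, List.ofFn_succ]

theorem levelSum_mono (n : ℕ) {f g : Series} (h : ∀ w : Word, w.length = n → f w ≤ g w) :
    levelSum n f ≤ levelSum n g :=
  Finset.sum_le_sum fun x _ => h _ (by simp)

theorem abs_levelSum_le (n : ℕ) (f : Series) : |levelSum n f| ≤ levelSum n (fun w => |f w|) :=
  Finset.abs_sum_le_sum_abs _ _

theorem levelSum_add (n : ℕ) (f g : Series) :
    levelSum n (fun w => f w + g w) = levelSum n f + levelSum n g :=
  Finset.sum_add_distrib

theorem levelSum_mul (n : ℕ) (r : ℝ) (f : Series) :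
    levelSum n (fun w => r * f w) = r * levelSum n f :=
  (Finset.mul_sum _ _ _).symm

theorem levelSum_nonneg (n : ℕ) {f : Series} (h : ∀ w, 0 ≤ f w) : 0 ≤ levelSum n f :=
  Finset.sum_nonneg fun _ _ => h _

theorem levelSum_ofWord_nil_mul (n : ℕ) (f : Series) :
    levelSum n (fun w => ofWord [] w * f w) = if n = 0 then f [] else 0 := by
  cases n with
  | zero => simp [ofWord]
  | succ n => simp [levelSum, ofWord]

/-- A sum over words is summed level by level. -/
theorem hasSum_levelSum {f : Series} {b : ℕ → ℝ} (hb : Summable b)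
    (h : ∀ n, levelSum n (fun w => |f w|) ≤ b n) :
    Summable (fun w => |f w|) ∧ HasSum (fun n => levelSum n f) (∑' w, f w) := by
  have h1 : Summable (fun w => |f w|) := by
    rw [← List.equivSigmaTuple.symm.summable_iff]
    refine (summable_sigma_of_nonneg fun _ => abs_nonneg _).2 ⟨fun n => Summable.of_finite, ?_⟩
    simp only [tsum_fintype]
    exact hb.of_nonneg_of_le (fun n => levelSum_nonneg n (f := fun w => |f w|) fun _ => abs_nonneg _) h
  refine ⟨h1, ?_⟩
  have h2 := (List.equivSigmaTuple.symm.hasSum_iff (f := f)).2 h1.of_abs.hasSum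
  exact h2.sigma fun n => hasSum_fintype _

/-- Rearrangement of a sum of Leibniz type over an antidiagonal. -/
theorem sum_antidiagonal_leibniz (n : ℕ) (A B : ℕ × ℕ → ℝ) (hA : ∀ l, A (0, l) = 0)
    (hB : ∀ k, B (k, 0) = 0) :
    ∑ p ∈ Finset.HasAntidiagonal.antidiagonal (n + 1), (A p + B p) =
      ∑ p ∈ Finset.HasAntidiagonal.antidiagonal n, (A (p.1 + 1, p.2) + B (p.1, p.2 + 1)) := by
  rw [Finset.sum_add_distrib, Finset.sum_add_distrib, Finset.Nat.sum_antidiagonal_succ,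
    Finset.Nat.sum_antidiagonal_succ', hA, hB, zero_add, zero_add]

/-- The `ℓ¹` norm of the coefficients of length `n`, normalized by `n!`. -/
noncomputable def levelNorm (n : ℕ) (P : Series) : ℝ :=
  levelSum n (fun w => |P w|) / n.factorial

theorem levelNorm_nonneg (n : ℕ) (P : Series) : 0 ≤ levelNorm n P :=
  div_nonneg (levelSum_nonneg n fun _ => abs_nonneg _) (by positivity)

theorem levelNorm_succ (n : ℕ) (P : Series) :
    ((n : ℝ) + 1) * levelNorm (n + 1) P = ∑ d, levelNorm n (leftDer d P) := by
  rw [levelNorm, levelSum_succ, Nat.factorial_succ]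
  simp only [levelNorm, ← Finset.sum_div]
  have : (n : ℝ) + 1 ≠ 0 := by positivity
  push_cast
  field_simp
  rfl

theorem levelNorm_add_le (n : ℕ) (P Q : Series) :
    levelNorm n (P + Q) ≤ levelNorm n P + levelNorm n Q := by
  rw [levelNorm, levelNorm, levelNorm, ← add_div, ← levelSum_add]
  gcongr
  exact levelSum_mono n fun w _ => abs_add_le _ _

theorem levelNorm_smul (n : ℕ) (r : ℝ) (P : Series) :
    levelNorm n (r • P) = |r| * levelNorm n P := by
  simp only [levelNorm, Pi.smul_apply, smul_eq_mul, abs_mul, levelSum_mul, mul_div_assoc]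

theorem levelNorm_one (n : ℕ) : levelNorm n (ofWord []) = if n = 0 then 1 else 0 := by
  have h := levelSum_ofWord_nil_mul n (fun _ => 1)
  have e : (fun w => |ofWord [] w|) = fun w => ofWord [] w * 1 := by
    funext w; simp only [ofWord]; split_ifs <;> simp
  rw [levelNorm, e, h]
  split_ifs with h0 <;> simp [h0]

theorem levelNorm_shuffle_le (n : ℕ) (P Q : Series) :
    levelNorm n (shuffle P Q) ≤
      ∑ p ∈ Finset.HasAntidiagonal.antidiagonal n, levelNorm p.1 P * levelNorm p.2 Q := by
  induction n generalizing P Q with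
  | zero => simp [levelNorm, abs_mul]
  | succ n ih =>
    have hn : (0 : ℝ) < (n : ℝ) + 1 := by positivity
    refine le_of_mul_le_mul_left ?_ hn
    have h := sum_antidiagonal_leibniz n
      (fun p => (p.1 : ℝ) * levelNorm p.1 P * levelNorm p.2 Q)
      (fun p => levelNorm p.1 P * ((p.2 : ℝ) * levelNorm p.2 Q)) (by simp) (by simp)
    have h' : ((n : ℝ) + 1) * ∑ p ∈ Finset.HasAntidiagonal.antidiagonal (n + 1), levelNorm p.1 P * levelNorm p.2 Q =
        ∑ p ∈ Finset.HasAntidiagonal.antidiagonal (n + 1), ((p.1 : ℝ) * levelNorm p.1 P * levelNorm p.2 Q +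
          levelNorm p.1 P * ((p.2 : ℝ) * levelNorm p.2 Q)) := by
      rw [Finset.mul_sum]
      refine Finset.sum_congr rfl fun p hp => ?_
      have : (p.1 : ℝ) + p.2 = n + 1 := by exact_mod_cast Finset.HasAntidiagonal.mem_antidiagonal.1 hp
      rw [← this]
      ring
    rw [h', h, levelNorm_succ]
    push_cast
    simp only [levelNorm_succ, Finset.sum_mul, Finset.mul_sum, ← Finset.sum_add_distrib]
    rw [Finset.sum_comm]
    refine Finset.sum_le_sum fun d _ => ?_
    rw [leftDer_shuffle, Finset.sum_add_distrib]
    exact (levelNorm_add_le n _ _).trans (add_le_add (ih _ _) (ih _ _))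

/-- A solution of `Y = a + 2bY - c(Y⧢Y)` has coefficients of total mass at most `n!` in
length `n`. -/
theorem levelNorm_le_one (Y : Series) (h0 : Y [] = 0)
    (ha : leftDer Letter.a Y = ofWord []) (hb : leftDer Letter.b Y = (2 : ℝ) • Y)
    (hc : leftDer Letter.c Y = (-1 : ℝ) • shuffle Y Y) (n : ℕ) : levelNorm n Y ≤ 1 := by
  have hz : levelNorm 0 Y = 0 := by simp [levelNorm, h0]
  have hs : ∀ n : ℕ, ((n : ℝ) + 1) * levelNorm (n + 1) Y ≤ (if n = 0 then 1 else 0) +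
      2 * levelNorm n Y + ∑ p ∈ Finset.HasAntidiagonal.antidiagonal n, levelNorm p.1 Y * levelNorm p.2 Y := by
    intro n
    rw [levelNorm_succ, sum_letter, ha, hb, hc, levelNorm_one, levelNorm_smul, levelNorm_smul]
    have := levelNorm_shuffle_le n Y Y
    norm_num
    exact this
  induction n using Nat.strong_induction_on with
  | _ n ih =>
    match n with
    | 0 => simp [hz]
    | 1 => simpa [hz] using hs 0
    | 2 =>
      have := hs 1
      have h1 := ih 1 (by simp)
      norm_num [Finset.Nat.sum_antidiagonal_succ, hz] at this
      linarith
    | j + 3 =>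
      have h := hs (j + 2)
      rw [Finset.Nat.sum_antidiagonal_succ, Finset.Nat.sum_antidiagonal_succ'] at h
      simp only [hz, zero_mul, mul_zero, zero_add] at h
      have hsum : ∑ p ∈ Finset.HasAntidiagonal.antidiagonal j, levelNorm (p.1 + 1) Y * levelNorm (p.2 + 1) Y
          ≤ j + 1 := by
        refine (Finset.sum_le_card_nsmul _ _ 1 fun p hp => ?_).trans (by simp)
        have := Finset.HasAntidiagonal.mem_antidiagonal.1 hp
        exact mul_le_one₀ (ih _ (by omega)) (levelNorm_nonneg _ _) (ih _ (by omega))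
      have h2 := ih (j + 2) (by omega)
      have hj : (0 : ℝ) < (j : ℝ) + 2 + 1 := by positivity
      push_cast at h
      refine le_of_mul_le_mul_left ?_ hj
      linarith

/-- Integration by parts for two functions given as primitives. -/
theorem mul_sub_mul_eq_integral {F G f g : ℝ → ℝ} {t : ℝ} (ht : 0 ≤ t)
    (hf : IntervalIntegrable f volume 0 t) (hg : IntervalIntegrable g volume 0 t)
    (hF : ∀ s ∈ Set.Icc 0 t, F s = F 0 + ∫ r in (0 : ℝ)..s, f r)
    (hG : ∀ s ∈ Set.Icc 0 t, G s = G 0 + ∫ r in (0 : ℝ)..s, g r) :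
    F t * G t - F 0 * G 0 = ∫ s in (0 : ℝ)..t, (f s * G s + F s * g s) := by
  have hac : ∀ {h : ℝ → ℝ} (c : ℝ), IntervalIntegrable h volume 0 t →
      AbsolutelyContinuousOnInterval (fun s => c + ∫ r in (0 : ℝ)..s, h r) 0 t := fun c hh =>
    AbsolutelyContinuousOnInterval.fun_add
      ((LipschitzWith.const c).lipschitzOnWith.absolutelyContinuousOnInterval)
      (hh.absolutelyContinuousOnInterval_intervalIntegral (by simp))
  have h := (hac (F 0) hf).integral_deriv_mul_eq_sub (hac (G 0) hg)
  rw [← hF t ⟨ht, le_rfl⟩, ← hG t ⟨ht, le_rfl⟩] at h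
  simp only [intervalIntegral.integral_same, add_zero] at h
  rw [← h]
  refine intervalIntegral.integral_congr_ae ?_
  filter_upwards [hf.ae_hasDerivAt_integral, hg.ae_hasDerivAt_integral] with s h1 h2 hs
  have hs' := Set.uIoc_subset_uIcc hs
  have hs'' : s ∈ Set.Icc 0 t := by rwa [Set.uIcc_of_le ht] at hs'
  rw [((h1 hs' 0 (by simp)).const_add (F 0)).deriv, ((h2 hs' 0 (by simp)).const_add (G 0)).deriv,
    ← hF s hs'', ← hG s hs'']

theorem intervalIntegrable_of_abs_le {f : ℝ → ℝ} (hf : Measurable f) {T M : ℝ}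
    (hM : ∀ t ∈ Set.Icc 0 T, |f t| ≤ M) {t : ℝ} (ht : t ∈ Set.Icc 0 T) :
    IntervalIntegrable f volume 0 t := by
  rw [intervalIntegrable_iff_integrableOn_Ioc_of_le ht.1]
  refine Measure.integrableOn_of_bounded (M := M) (by simp) hf.aestronglyMeasurable ?_
  refine (ae_restrict_iff' measurableSet_Ioc).2 (Filter.Eventually.of_forall fun s hs => ?_)
  exact hM s ⟨hs.1.le, hs.2.trans ht.2⟩

theorem continuousOn_UpsRev {u : Letter → ℝ → ℝ} {T : ℝ}
    (hu : ∀ d, ∀ t ∈ Set.Icc 0 T, IntervalIntegrable (u d) volume 0 t) (w : Word) :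
    ContinuousOn (UpsRev u w) (Set.Icc 0 T) := by
  rcases lt_or_ge T 0 with hT | hT
  · simp [Set.Icc_eq_empty_of_lt hT]
  induction w with
  | nil => exact continuousOn_const
  | cons d w ih =>
    rw [← Set.uIcc_of_le hT] at ih ⊢
    exact intervalIntegral.continuousOn_primitive_interval'
      ((hu d T ⟨hT, le_rfl⟩).mul_continuousOn ih) (by simp)

theorem abs_UpsRev_le {u : Letter → ℝ → ℝ} {T M : ℝ}
    (hM : ∀ d, ∀ t ∈ Set.Icc 0 T, |u d t| ≤ M) (w : Word) {t : ℝ} (ht : t ∈ Set.Icc 0 T) :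
    |UpsRev u w t| ≤ (M * t) ^ w.length / w.length.factorial := by
  induction w generalizing t with
  | nil => simp [UpsRev]
  | cons d w ih =>
    have hM0 : 0 ≤ M := (abs_nonneg _).trans (hM d t ht)
    have hI : IntervalIntegrable (fun s => M * (M ^ w.length / w.length.factorial * s ^ w.length))
        volume 0 t := Continuous.intervalIntegrable (by fun_prop) _ _
    have h : |UpsRev u (d :: w) t| ≤
        ∫ s in (0 : ℝ)..t, M * (M ^ w.length / w.length.factorial * s ^ w.length) := by
      rw [UpsRev, ← Real.norm_eq_abs]
      refine intervalIntegral.norm_integral_le_of_norm_le ht.1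
        (Filter.Eventually.of_forall fun s hs => ?_) hI
      have hs' : s ∈ Set.Icc 0 T := ⟨hs.1.le, hs.2.trans ht.2⟩
      rw [norm_mul]
      refine mul_le_mul (hM d s hs') ((ih hs').trans_eq ?_) (norm_nonneg _) hM0
      rw [mul_pow]; ring
    refine h.trans_eq ?_
    rw [intervalIntegral.integral_const_mul, intervalIntegral.integral_const_mul, integral_pow,
      List.length_cons, Nat.factorial_succ]
    push_cast
    field_simp
    ring

/-- The contribution of the words of length `n` to the evaluation `Σ_w ⟨P,w⟩ Υ^t(w)`, with
reversed words. -/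
noncomputable def levelUps (u : Letter → ℝ → ℝ) (n : ℕ) (P : Series) (t : ℝ) : ℝ :=
  levelSum n (fun w => P w * UpsRev u w t)

theorem levelUps_zero (u : Letter → ℝ → ℝ) (P : Series) (t : ℝ) : levelUps u 0 P t = P [] := by
  simp [levelUps, UpsRev]

theorem levelUps_add (u : Letter → ℝ → ℝ) (n : ℕ) (P Q : Series) (t : ℝ) :
    levelUps u n (P + Q) t = levelUps u n P t + levelUps u n Q t := by
  simp only [levelUps, Pi.add_apply, add_mul, levelSum_add]

theorem levelUps_smul (u : Letter → ℝ → ℝ) (n : ℕ) (r : ℝ) (P : Series) (t : ℝ) :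
    levelUps u n (r • P) t = r * levelUps u n P t := by
  simp only [levelUps, Pi.smul_apply, smul_eq_mul, mul_assoc, levelSum_mul]

theorem levelUps_one (u : Letter → ℝ → ℝ) (n : ℕ) (t : ℝ) :
    levelUps u n (ofWord []) t = if n = 0 then 1 else 0 := by
  simp [levelUps, levelSum_ofWord_nil_mul, UpsRev]

theorem continuousOn_levelUps {u : Letter → ℝ → ℝ} {T : ℝ}
    (hu : ∀ d, ∀ t ∈ Set.Icc 0 T, IntervalIntegrable (u d) volume 0 t) (n : ℕ) (P : Series) :
    ContinuousOn (levelUps u n P) (Set.Icc 0 T) :=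
  continuousOn_finsetSum _ fun _ _ => continuousOn_const.mul (continuousOn_UpsRev hu _)

theorem intervalIntegrable_mul_levelUps {u : Letter → ℝ → ℝ} {T : ℝ}
    (hu : ∀ d, ∀ t ∈ Set.Icc 0 T, IntervalIntegrable (u d) volume 0 t) (d : Letter) (n : ℕ)
    (P : Series) {t : ℝ} (ht : t ∈ Set.Icc 0 T) :
    IntervalIntegrable (fun s => u d s * levelUps u n P s) volume 0 t := by
  refine (hu d t ht).mul_continuousOn ((continuousOn_levelUps hu n P).mono ?_)
  rw [Set.uIcc_of_le ht.1]
  exact Set.Icc_subset_Icc_right ht.2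

/-- The derivative of `levelUps u n P`. -/
noncomputable def levelUpsDer (u : Letter → ℝ → ℝ) : ℕ → Series → ℝ → ℝ
  | 0, _, _ => 0
  | n + 1, P, t => ∑ d, u d t * levelUps u n (leftDer d P) t

theorem intervalIntegrable_levelUpsDer {u : Letter → ℝ → ℝ} {T : ℝ}
    (hu : ∀ d, ∀ t ∈ Set.Icc 0 T, IntervalIntegrable (u d) volume 0 t) (n : ℕ)
    (P : Series) {t : ℝ} (ht : t ∈ Set.Icc 0 T) :
    IntervalIntegrable (levelUpsDer u n P) volume 0 t := by
  cases n with
  | zero => exact intervalIntegrable_const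
  | succ n =>
    have := IntervalIntegrable.sum Finset.univ fun d _ =>
      intervalIntegrable_mul_levelUps hu d n (leftDer d P) ht
    convert! this using 1

theorem levelUps_succ {u : Letter → ℝ → ℝ} {T : ℝ}
    (hu : ∀ d, ∀ t ∈ Set.Icc 0 T, IntervalIntegrable (u d) volume 0 t) (n : ℕ)
    (P : Series) {t : ℝ} (ht : t ∈ Set.Icc 0 T) :
    levelUps u (n + 1) P t = ∫ s in (0 : ℝ)..t, levelUpsDer u (n + 1) P s := by
  have hsub : Set.uIcc 0 t ⊆ Set.Icc 0 T := by
    rw [Set.uIcc_of_le ht.1]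
    exact Set.Icc_subset_Icc_right ht.2
  simp only [levelUpsDer]
  rw [intervalIntegral.integral_finsetSum
    fun d _ => intervalIntegrable_mul_levelUps hu d n (leftDer d P) ht, levelUps, levelSum_succ]
  refine Finset.sum_congr rfl fun d _ => ?_
  simp only [levelUps, levelSum, Finset.mul_sum, leftDer_apply, UpsRev]
  rw [intervalIntegral.integral_finsetSum]
  · refine Finset.sum_congr rfl fun x _ => ?_
    rw [← intervalIntegral.integral_const_mul]
    simp only [mul_left_comm]
  · intro x _
    exact (hu d t ht).mul_continuousOn
      (continuousOn_const.mul ((continuousOn_UpsRev hu _).mono hsub))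

theorem levelUps_eq_add_integral {u : Letter → ℝ → ℝ} {T : ℝ}
    (hu : ∀ d, ∀ t ∈ Set.Icc 0 T, IntervalIntegrable (u d) volume 0 t) (n : ℕ)
    (P : Series) {t : ℝ} (ht : t ∈ Set.Icc 0 T) :
    levelUps u n P t = levelUps u n P 0 + ∫ s in (0 : ℝ)..t, levelUpsDer u n P s := by
  cases n with
  | zero => simp [levelUps_zero, levelUpsDer]
  | succ n =>
    rw [levelUps_succ hu n P ht, levelUps_succ hu n P ⟨le_rfl, ht.1.trans ht.2⟩]
    simp

/-- Evaluation is multiplicative for the shuffle product. -/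
theorem levelUps_shuffle {u : Letter → ℝ → ℝ} {T : ℝ}
    (hu : ∀ d, ∀ t ∈ Set.Icc 0 T, IntervalIntegrable (u d) volume 0 t) (n : ℕ)
    (P Q : Series) {t : ℝ} (ht : t ∈ Set.Icc 0 T) :
    levelUps u n (shuffle P Q) t =
      ∑ p ∈ Finset.HasAntidiagonal.antidiagonal n, levelUps u p.1 P t * levelUps u p.2 Q t := by
  induction n generalizing P Q t with
  | zero => simp [levelUps_zero]
  | succ n ih =>
    have hsub : Set.uIcc 0 t ⊆ Set.Icc 0 T := by
      rw [Set.uIcc_of_le ht.1]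
      exact Set.Icc_subset_Icc_right ht.2
    have hbd : ∀ p ∈ Finset.HasAntidiagonal.antidiagonal (n + 1),
        levelUps u p.1 P 0 * levelUps u p.2 Q 0 = 0 := by
      rintro ⟨k, l⟩ hp
      have h0 : (0 : ℝ) ∈ Set.Icc 0 T := ⟨le_rfl, ht.1.trans ht.2⟩
      match k, l with
      | k + 1, l => simp [levelUps_succ hu k P h0]
      | k, l + 1 => simp [levelUps_succ hu l Q h0]
      | 0, 0 => simp at hp
    have hparts : ∀ p ∈ Finset.HasAntidiagonal.antidiagonal (n + 1),
        levelUps u p.1 P t * levelUps u p.2 Q t =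
          ∫ s in (0 : ℝ)..t, (levelUpsDer u p.1 P s * levelUps u p.2 Q s +
            levelUps u p.1 P s * levelUpsDer u p.2 Q s) := by
      intro p hp
      rw [← mul_sub_mul_eq_integral ht.1 (intervalIntegrable_levelUpsDer hu p.1 P ht)
        (intervalIntegrable_levelUpsDer hu p.2 Q ht), hbd p hp, sub_zero]
      · exact fun s hs => levelUps_eq_add_integral hu _ _ ⟨hs.1, hs.2.trans ht.2⟩
      · exact fun s hs => levelUps_eq_add_integral hu _ _ ⟨hs.1, hs.2.trans ht.2⟩
    rw [Finset.sum_congr rfl hparts, ← intervalIntegral.integral_finsetSum, levelUps_succ hu n _ ht]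
    · refine intervalIntegral.integral_congr fun s hs => ?_
      have hs' := hsub hs
      rw [sum_antidiagonal_leibniz n
        (fun p => levelUpsDer u p.1 P s * levelUps u p.2 Q s)
        (fun p => levelUps u p.1 P s * levelUpsDer u p.2 Q s) (by simp [levelUpsDer])
        (by simp [levelUpsDer])]
      simp only [levelUpsDer, leftDer_shuffle, levelUps_add, ih _ _ hs', Finset.sum_mul,
        Finset.mul_sum, Finset.sum_add_distrib, mul_add]
      rw [Finset.sum_comm (s := Finset.HasAntidiagonal.antidiagonal n),
        Finset.sum_comm (s := Finset.HasAntidiagonal.antidiagonal n)]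
      simp only [mul_assoc, mul_left_comm]
    · intro p _
      exact ((intervalIntegrable_levelUpsDer hu p.1 P ht).mul_continuousOn
        ((continuousOn_levelUps hu p.2 Q).mono hsub)).add
        ((intervalIntegrable_levelUpsDer hu p.2 Q ht).continuousOn_mul
        ((continuousOn_levelUps hu p.1 P).mono hsub))

theorem levelSum_abs_mul_UpsRev_le {u : Letter → ℝ → ℝ} {T M : ℝ}
    (hM : ∀ d, ∀ t ∈ Set.Icc 0 T, |u d t| ≤ M) (n : ℕ) (P : Series) {t : ℝ}
    (ht : t ∈ Set.Icc 0 T) :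
    levelSum n (fun w => |P w * UpsRev u w t|) ≤ (M * t) ^ n * levelNorm n P := by
  rw [levelNorm, mul_div_left_comm, mul_comm, ← levelSum_mul]
  refine levelSum_mono n fun w hw => ?_
  rw [abs_mul, mul_comm]
  exact mul_le_mul_of_nonneg_right (hw ▸ abs_UpsRev_le hM w ht) (abs_nonneg _)

/-- If `Y = a + 2bY - c(Y⧢Y)` then its evaluation converges absolutely for small times and
solves the Riccati equation in integral form. -/
theorem riccati_of_leftDer {u : Letter → ℝ → ℝ} {T M : ℝ}
    (hu : ∀ d, ∀ t ∈ Set.Icc 0 T, IntervalIntegrable (u d) volume 0 t)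
    (hM : ∀ d, ∀ t ∈ Set.Icc 0 T, |u d t| ≤ M) (hMT : M * T ≤ 1 / 2)
    (Y : Series) (h0 : Y [] = 0)
    (ha : leftDer Letter.a Y = ofWord []) (hb : leftDer Letter.b Y = (2 : ℝ) • Y)
    (hc : leftDer Letter.c Y = (-1 : ℝ) • shuffle Y Y)
    (Ξ : ℝ → ℝ) (hΞ : ∀ t, Ξ t = ∑' w, Y w * UpsRev u w t) :
    (∀ t ∈ Set.Icc 0 T, Summable (fun w => |Y w * UpsRev u w t|)) ∧
      ContinuousOn Ξ (Set.Icc 0 T) ∧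
      ∀ t ∈ Set.Icc 0 T, Ξ t = ∫ s in (0 : ℝ)..t,
        (u Letter.a s + 2 * u Letter.b s * Ξ s - u Letter.c s * Ξ s ^ 2) := by
  have hgeo : Summable (fun n : ℕ => (1 / 2 : ℝ) ^ n) := summable_geometric_two
  have hlev : ∀ n, ∀ t ∈ Set.Icc 0 T,
      levelSum n (fun w => |Y w * UpsRev u w t|) ≤ (1 / 2) ^ n := by
    intro n t ht
    have hM0 : 0 ≤ M := (abs_nonneg _).trans (hM Letter.a t ht)
    have hMt : M * t ≤ 1 / 2 := (mul_le_mul_of_nonneg_left ht.2 hM0).trans hMT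
    have hMt0 : 0 ≤ M * t := mul_nonneg hM0 ht.1
    calc _ ≤ (M * t) ^ n * levelNorm n Y := levelSum_abs_mul_UpsRev_le hM n Y ht
      _ ≤ (M * t) ^ n * 1 := by gcongr; exact levelNorm_le_one Y h0 ha hb hc n
      _ ≤ (1 / 2) ^ n := by rw [mul_one]; gcongr
  have habs : ∀ n, ∀ t ∈ Set.Icc 0 T, ‖levelUps u n Y t‖ ≤ (1 / 2) ^ n := fun n t ht =>
    (abs_levelSum_le n _).trans (hlev n t ht)
  have hsum : ∀ t ∈ Set.Icc 0 T, HasSum (fun n => levelUps u n Y t) (Ξ t) := fun t ht => by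
    rw [hΞ]
    exact (hasSum_levelSum hgeo fun n => hlev n t ht).2
  have hder : ∀ n, ∀ t ∈ Set.Icc 0 T, levelUpsDer u (n + 1) Y t =
      u Letter.a t * (if n = 0 then 1 else 0) + 2 * u Letter.b t * levelUps u n Y t -
        u Letter.c t * ∑ p ∈ Finset.HasAntidiagonal.antidiagonal n,
          levelUps u p.1 Y t * levelUps u p.2 Y t := by
    intro n t ht
    rw [levelUpsDer, sum_letter, ha, hb, hc, levelUps_one, levelUps_smul, levelUps_smul,
      levelUps_shuffle hu n Y Y ht]
    ring
  refine ⟨fun t ht => (hasSum_levelSum hgeo fun n => hlev n t ht).1, ?_, fun t ht => ?_⟩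
  · exact (continuousOn_tsum (fun n => continuousOn_levelUps hu n Y) hgeo habs).congr
      fun t ht => (hsum t ht).tsum_eq.symm
  have hmem : ∀ s ∈ Set.uIoc 0 t, s ∈ Set.Icc 0 T := fun s hs => by
    rw [Set.uIoc_of_le ht.1] at hs
    exact ⟨hs.1.le, hs.2.trans ht.2⟩
  have hM0 : 0 ≤ M := (abs_nonneg _).trans (hM Letter.a t ht)
  have h1 := (hasSum_nat_add_iff' 1).2 (hsum t ht)
  simp only [Finset.range_one, Finset.sum_singleton, levelUps_zero, h0, sub_zero,
    levelUps_succ hu _ Y ht] at h1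
  refine h1.unique (intervalIntegral.hasSum_integral_of_dominated_convergence
    (fun n _ => M * (3 * (1 / 2) ^ n + ((n : ℝ) + 1) * (1 / 2) ^ n)) (fun n => ?_) (fun n => ?_)
    ?_ intervalIntegrable_const ?_)
  · exact ((intervalIntegrable_iff.1 (intervalIntegrable_levelUpsDer hu (n + 1) Y ht))).1
  · refine Filter.Eventually.of_forall fun s hs => ?_
    have hs' := hmem s hs
    rw [hder n s hs']
    have e1 : |(if n = 0 then (1 : ℝ) else 0)| ≤ (1 / 2) ^ n := by
      split_ifs with hn <;> simp [hn]
    have e3 : |∑ p ∈ Finset.HasAntidiagonal.antidiagonal n,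
        levelUps u p.1 Y s * levelUps u p.2 Y s| ≤ ((n : ℝ) + 1) * (1 / 2) ^ n := by
      refine (Finset.abs_sum_le_sum_abs _ _).trans
        ((Finset.sum_le_card_nsmul _ _ ((1 / 2) ^ n) fun p hp => ?_).trans_eq (by simp))
      rw [← Finset.HasAntidiagonal.mem_antidiagonal.1 hp, pow_add, abs_mul]
      exact mul_le_mul (habs _ s hs') (habs _ s hs') (abs_nonneg _) (by positivity)
    calc _ ≤ |u Letter.a s| * |(if n = 0 then (1 : ℝ) else 0)| +
          2 * |u Letter.b s| * |levelUps u n Y s| +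
          |u Letter.c s| * |∑ p ∈ Finset.HasAntidiagonal.antidiagonal n,
            levelUps u p.1 Y s * levelUps u p.2 Y s| := by
          refine (abs_sub _ _).trans (add_le_add ((abs_add_le _ _).trans_eq ?_) (abs_mul _ _).le)
          rw [abs_mul, abs_mul, abs_mul, abs_two]
      _ ≤ M * (1 / 2) ^ n + 2 * M * (1 / 2) ^ n + M * (((n : ℝ) + 1) * (1 / 2) ^ n) := by
          gcongr
          · exact hM _ s hs'
          · exact hM _ s hs'
          · exact habs n s hs'
          · exact hM _ s hs'
      _ = _ := by ring
  · refine Filter.Eventually.of_forall fun s _ => ?_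
    have hlin : Summable (fun n : ℕ => (n : ℝ) * (1 / 2) ^ n) := by
      simpa using summable_pow_mul_geometric_of_norm_lt_one 1 (r := (1 / 2 : ℝ)) (by norm_num)
    simp only [add_mul, one_mul]
    exact ((hgeo.mul_left 3).add (hlin.add hgeo)).mul_left M
  · refine Filter.Eventually.of_forall fun s hs => ?_
    have hs' := hmem s hs
    simp only [hder _ s hs']
    have hn : Summable (fun n => ‖levelUps u n Y s‖) :=
      hgeo.of_nonneg_of_le (fun _ => norm_nonneg _) fun n => habs n s hs'
    have hprod : HasSum (fun n => ∑ p ∈ Finset.HasAntidiagonal.antidiagonal n,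
        levelUps u p.1 Y s * levelUps u p.2 Y s) (Ξ s ^ 2) := by
      have h := (summable_norm_sum_mul_antidiagonal_of_summable_norm hn hn).of_norm.hasSum
      rwa [← tsum_mul_tsum_eq_tsum_sum_antidiagonal_of_summable_norm hn hn,
        (hsum s hs').tsum_eq, ← sq] at h
    have hone : HasSum (fun n : ℕ => if n = 0 then (1 : ℝ) else 0) 1 := hasSum_ite_eq 0 1
    have := ((hone.mul_left (u Letter.a s)).add
      ((hsum s hs').mul_left (2 * u Letter.b s))).sub (hprod.mul_left (u Letter.c s))
    simpa using this

/-- Let `u_a, u_b, u_c` be bounded measurable on `[0,T]` (`T > 0`) and let `S` be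
the (unique) zero-constant-term solution of `S = b − a·exp⧢(2S)·c`.  Then there is
`T′ ∈ (0,T]` such that for all `t ∈ [0,T′]` the series
`Ξ_a(t) = Σ_{w∈A*} ⟨a·exp⧢(2S), w⟩·Υ^t(w)` converges absolutely, and `Ξ_a` is
absolutely continuous on `[0,T′]` — expressed by the integral identity
`Ξ_a(t) = ∫₀^t (u_a + 2u_b·Ξ_a − u_c·Ξ_a²)` — with `Ξ_a(0) = 0` and
`Ξ_a′(t) = u_a(t) + 2u_b(t)·Ξ_a(t) − u_c(t)·Ξ_a(t)²` almost everywhere on `[0,T′]`. -/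
theorem xiA_solves_riccati (T : ℝ) (hT : 0 < T) (u : Letter → ℝ → ℝ)
    (hmeas : ∀ d, Measurable (u d))
    (hbdd : ∀ d, ∃ M : ℝ, ∀ t ∈ Set.Icc (0 : ℝ) T, |u d t| ≤ M)
    (S : Series) (h0 : S [] = 0)
    (hS : S = ofWord [Letter.b] -
        cmul (ofWord [Letter.a]) (cmul (shufExp ((2 : ℝ) • S)) (ofWord [Letter.c]))) :
    ∃ T' : ℝ, 0 < T' ∧ T' ≤ T ∧
      (∀ t ∈ Set.Icc (0 : ℝ) T',
        Summable (fun w : Word =>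
          |cmul (ofWord [Letter.a]) (shufExp ((2 : ℝ) • S)) w * Ups u w t|)) ∧
      (fun t : ℝ => ∑' w : Word,
          cmul (ofWord [Letter.a]) (shufExp ((2 : ℝ) • S)) w * Ups u w t) 0 = 0 ∧
      (∀ t ∈ Set.Icc (0 : ℝ) T',
        (∑' w : Word, cmul (ofWord [Letter.a]) (shufExp ((2 : ℝ) • S)) w * Ups u w t) =
          ∫ s in (0 : ℝ)..t,
            (u Letter.a s +
              2 * u Letter.b s *
                (∑' w : Word, cmul (ofWord [Letter.a]) (shufExp ((2 : ℝ) • S)) w * Ups u w s) -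
              u Letter.c s *
                (∑' w : Word,
                    cmul (ofWord [Letter.a]) (shufExp ((2 : ℝ) • S)) w * Ups u w s) ^ 2)) ∧
      (∀ᵐ t ∂(volume.restrict (Set.Icc (0 : ℝ) T')),
        HasDerivAt
          (fun t : ℝ => ∑' w : Word,
            cmul (ofWord [Letter.a]) (shufExp ((2 : ℝ) • S)) w * Ups u w t)
          (u Letter.a t +
            2 * u Letter.b t *
              (∑' w : Word, cmul (ofWord [Letter.a]) (shufExp ((2 : ℝ) • S)) w * Ups u w t) -
            u Letter.c t *
              (∑' w : Word,
                  cmul (ofWord [Letter.a]) (shufExp ((2 : ℝ) • S)) w * Ups u w t) ^ 2)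
          t) := by
  set X : Series := cmul (ofWord [Letter.a]) (shufExp ((2 : ℝ) • S)) with hX
  set Ξ : ℝ → ℝ := fun t => ∑' w : Word, X w * Ups u w t with hΞ
  have hXc := cmul_shufExp_concat S h0 hS X hX
  choose K hK using hbdd
  set M : ℝ := ∑ d, |K d| + 1 with hMdef
  have hMpos : 0 < M := by positivity
  have hT1 : 0 < min T (1 / (2 * M)) := by positivity
  set T' : ℝ := min T (1 / (2 * M)) with hT'
  have hle : T' ≤ T := min_le_left _ _
  have hM : ∀ d, ∀ t ∈ Set.Icc 0 T', |u d t| ≤ M := fun d t ht => by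
    have h1 := hK d t ⟨ht.1, ht.2.trans hle⟩
    have h2 := Finset.single_le_sum (f := fun d => |K d|) (fun _ _ => abs_nonneg _)
      (Finset.mem_univ d)
    linarith [le_abs_self (K d)]
  have hMT : M * T' ≤ 1 / 2 := by
    refine (mul_le_mul_of_nonneg_left (min_le_right _ _) hMpos.le).trans_eq ?_
    field_simp
  have hu : ∀ d, ∀ t ∈ Set.Icc 0 T', IntervalIntegrable (u d) volume 0 t :=
    fun d t ht => intervalIntegrable_of_abs_le (hmeas d) (hM d) ht
  set Y : Series := fun w => X w.reverse with hY
  have hYc : ∀ d w, Y (d :: w) = (if d = Letter.a then ofWord [] w else 0) +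
      (if d = Letter.b then 2 * Y w else 0) - (if d = Letter.c then shuffle Y Y w else 0) := by
    intro d w
    simp only [hY, List.reverse_cons]
    rw [hXc, shuffle_reverse]
    simp [ofWord, ite_and]
  have hrev : ∀ t, (fun w => Y w * UpsRev u w t) =
      (fun w => X w * Ups u w t) ∘ (List.reverse_involutive.toPerm _ : Equiv.Perm Word) := by
    intro t
    funext w
    simp [hY, Ups]
  obtain ⟨hsum, hcont, hint⟩ := riccati_of_leftDer hu hM hMT Y (by simp [hY, hX])
    (by funext w; simp [hYc]) (by funext w; simp [hYc]) (by funext w; simp [hYc]) Ξ (fun t => by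
      rw [hrev]
      exact ((List.reverse_involutive.toPerm _).tsum_eq (fun w => X w * Ups u w t)).symm)
  have hg : IntervalIntegrable (fun s => u Letter.a s + 2 * u Letter.b s * Ξ s -
      u Letter.c s * Ξ s ^ 2) volume 0 T' := by
    have hT'm : T' ∈ Set.Icc 0 T' := ⟨hT1.le, le_rfl⟩
    rw [← Set.uIcc_of_le hT1.le] at hcont
    exact ((hu _ _ hT'm).add (((hu _ _ hT'm).const_mul 2).mul_continuousOn hcont)).sub
      ((hu _ _ hT'm).mul_continuousOn (hcont.pow 2))
  refine ⟨T', hT1, hle, fun t ht => ?_, ?_, hint, ?_⟩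
  · refine (List.reverse_involutive.toPerm _ : Equiv.Perm Word).summable_iff.1 ?_
    convert! hsum t ht using 1
    funext w
    exact (congrArg abs (congrFun (hrev t) w)).symm
  · simpa using hint 0 ⟨le_rfl, hT1.le⟩
  · rw [← restrict_Ioo_eq_restrict_Icc, ae_restrict_iff' measurableSet_Ioo]
    filter_upwards [hg.ae_hasDerivAt_integral] with t h ht
    have ht' : t ∈ Set.uIcc 0 T' := by
      rw [Set.uIcc_of_le hT1.le]
      exact Set.Ioo_subset_Icc_self ht
    refine (h ht' 0 (by simp)).congr_of_eventuallyEq ?_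
    filter_upwards [isOpen_Ioo.mem_nhds ht] with s hs
    exact hint s (Set.Ioo_subset_Icc_self hs)
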